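/- Let G be a finite simple graph on vertex set [n] and p ∈ [0,1)^n. If Z_G(−p; S) < 0 for some S ⊆ [n], then there exists a supermodular function f: 2^{[n]} → ℝ_{≥0} with f(∅) > 0 that factorizes according to p, G, such that f(T) = 0 for some T ⊆ [n]. -/

import Mathlib

open Finset

variable {n : ℕ}

open Classical in
/-- Independent set polynomial of the subgraph of `G` induced by `S`, i.e. `Z_G(x; S)`. -/
noncomputable def Zpoly (G : SimpleGraph (Fin n)) (x : Fin n → ℝ) (S : Finset (Fin n)) : ℝ :=
  ∑ I ∈ S.powerset.filter (fun I => ∀ a ∈ I, ∀ b ∈ I, ¬ G.Adj a b), ∏ i ∈ I, x i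

/-- `f : 2^{[n]} → ℝ` is supermodular: discrete derivatives are increasing. -/
def Supermodular (f : Finset (Fin n) → ℝ) : Prop :=
  ∀ (i : Fin n) (S T : Finset (Fin n)), S ⊆ T → i ∉ T →
    f (insert i S) - f S ≤ f (insert i T) - f T

/-- `f` factorizes according to `p, G`: `f(S ∪ {i}) ≥ (1 - p_i) f(S)` whenever `S` contains
neither `i` nor any neighbor of `i`. -/
def Factorizes (f : Finset (Fin n) → ℝ) (p : Fin n → ℝ) (G : SimpleGraph (Fin n)) : Prop :=
  ∀ (i : Fin n) (S : Finset (Fin n)), (∀ j ∈ S, j ≠ i ∧ ¬ G.Adj i j) →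
    (1 - p i) * f S ≤ f (insert i S)

theorem Zpoly_empty (G : SimpleGraph (Fin n)) (x : Fin n → ℝ) : Zpoly G x ∅ = 1 := by
  classical
  simp [Zpoly, Finset.filter_singleton]

open Classical in
/-- The deletion-contraction recursion for the independent set polynomial. -/
theorem Zpoly_insert (G : SimpleGraph (Fin n)) (x : Fin n → ℝ) {i : Fin n}
    {S : Finset (Fin n)} (hi : i ∉ S) :
    Zpoly G x (insert i S) = Zpoly G x S + x i * Zpoly G x (S.filter fun j => ¬ G.Adj i j) := by
  unfold Zpoly
  rw [Finset.sum_filter, Finset.sum_powerset_insert hi, ← Finset.sum_filter, Finset.mul_sum]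
  congr 1
  rw [← Finset.sum_filter]
  refine Finset.sum_congr ?_ fun I hI => ?_
  · ext I
    simp only [mem_filter, mem_powerset, mem_insert, forall_eq_or_imp, subset_iff]
    constructor
    · rintro ⟨hIS, ⟨-, h1⟩, h2⟩
      exact ⟨fun j hj => ⟨hIS hj, h1 j hj⟩, fun a ha => (h2 a ha).2⟩
    · rintro ⟨hIS, h⟩
      exact ⟨fun j hj => (hIS hj).1, ⟨G.loopless.irrefl i, fun j hj => (hIS hj).2⟩,
        fun a ha => ⟨fun hai => (hIS ha).2 hai.symm, h a ha⟩⟩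
  · rw [Finset.prod_insert]
    simp only [mem_filter, mem_powerset, subset_iff] at hI
    exact fun h => hi (hI.1 h).1

theorem continuous_Zpoly_smul (G : SimpleGraph (Fin n)) (x : Fin n → ℝ) (S : Finset (Fin n)) :
    Continuous fun t : ℝ => Zpoly G (fun i => -(t * x i)) S := by
  unfold Zpoly
  fun_prop

/-- Enlarging the vertex set decreases `Z_G(-q; ·)` when `q` and all `Z_G(-q; S)` are nonnegative. -/
theorem Zpoly_neg_antitone (G : SimpleGraph (Fin n)) {q : Fin n → ℝ} (hq : ∀ i, 0 ≤ q i)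
    (hZ : ∀ S, 0 ≤ Zpoly G (fun i => -q i) S) : Antitone (Zpoly G fun i => -q i) := by
  classical
  refine Finset.antitone_iff_forall_insert_le.2 fun S i hi => ?_
  rw [Zpoly_insert G _ hi]
  nlinarith [mul_nonneg (hq i) (hZ (S.filter fun j => ¬ G.Adj i j))]

theorem supermodular_Zpoly_neg (G : SimpleGraph (Fin n)) {q : Fin n → ℝ} (hq : ∀ i, 0 ≤ q i)
    (hZ : ∀ S, 0 ≤ Zpoly G (fun i => -q i) S) : Supermodular (Zpoly G fun i => -q i) := by
  classical
  intro i S T hST hi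
  rw [Zpoly_insert G _ hi, Zpoly_insert G _ fun h => hi (hST h)]
  have := mul_le_mul_of_nonneg_left
    (Zpoly_neg_antitone G hq hZ (Finset.filter_subset_filter (fun j => ¬ G.Adj i j) hST)) (hq i)
  linarith

theorem factorizes_Zpoly_neg (G : SimpleGraph (Fin n)) {p q : Fin n → ℝ} (hqp : ∀ i, q i ≤ p i)
    (hZ : ∀ S, 0 ≤ Zpoly G (fun i => -q i) S) : Factorizes (Zpoly G fun i => -q i) p G := by
  classical
  intro i S hS
  rw [Zpoly_insert G _ fun h => (hS i h).1 rfl, Finset.filter_true_of_mem fun j hj => (hS j hj).2]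
  nlinarith [mul_le_mul_of_nonneg_right (hqp i) (hZ S)]

/-- Moving from `0` to `p`, there is a point where all `Z_G(-t p; S)` are nonnegative and one
of them vanishes, provided one is negative at `p`. -/
theorem exists_Zpoly_boundary (G : SimpleGraph (Fin n)) (p : Fin n → ℝ)
    (hZ : ∃ S : Finset (Fin n), Zpoly G (fun i => -p i) S < 0) :
    ∃ t ∈ Set.Icc (0 : ℝ) 1, (∀ S, 0 ≤ Zpoly G (fun i => -(t * p i)) S) ∧
      ∃ T, Zpoly G (fun i => -(t * p i)) T = 0 := by
  classical
  let g : ℝ → ℝ := fun t =>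
    (univ : Finset (Finset (Fin n))).inf' univ_nonempty fun S => Zpoly G (fun i => -(t * p i)) S
  have hg : Continuous g :=
    Continuous.finset_inf'_apply _ fun S _ => continuous_Zpoly_smul G p S
  have hg0 : 0 ≤ g 0 := by
    refine Finset.le_inf' _ _ fun S _ => ?_
    induction S using Finset.induction_on with
    | empty => simp [Zpoly_empty]
    | insert i S hi ih => rw [Zpoly_insert G _ hi]; simpa using ih
  have hg1 : g 1 ≤ 0 := by
    obtain ⟨S, hS⟩ := hZ
    refine (Finset.inf'_le _ (mem_univ S)).trans ?_
    simpa using hS.le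
  obtain ⟨t, ht, hgt⟩ := intermediate_value_Icc' zero_le_one hg.continuousOn ⟨hg1, hg0⟩
  refine ⟨t, ht, fun S => hgt ▸ Finset.inf'_le _ (mem_univ S), ?_⟩
  obtain ⟨T, -, hT⟩ := Finset.exists_mem_eq_inf' univ_nonempty
    fun S : Finset (Fin n) => Zpoly G (fun i => -(t * p i)) S
  exact ⟨T, hT.symm.trans hgt⟩

/-- If `Z_G(-p; S) < 0` for some `S ⊆ [n]`, then there exists a nonnegative
supermodular function `f` with `f(∅) > 0` that factorizes according to `p, G` and vanishes
at some `T ⊆ [n]`. -/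
theorem supermodular_shearer_converse (G : SimpleGraph (Fin n)) (p : Fin n → ℝ)
    (hp : ∀ i, 0 ≤ p i ∧ p i < 1)
    (hZ : ∃ S : Finset (Fin n), Zpoly G (fun i => -p i) S < 0) :
    ∃ f : Finset (Fin n) → ℝ,
      (∀ S, 0 ≤ f S) ∧ Supermodular f ∧ 0 < f ∅ ∧ Factorizes f p G ∧
        ∃ T : Finset (Fin n), f T = 0 := by
  obtain ⟨t, ⟨ht0, ht1⟩, hnonneg, hzero⟩ := exists_Zpoly_boundary G p hZ
  exact ⟨Zpoly G fun i => -(t * p i), hnonneg,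
    supermodular_Zpoly_neg G (fun i => mul_nonneg ht0 (hp i).1) hnonneg,
    by rw [Zpoly_empty]; exact one_pos,
    factorizes_Zpoly_neg G (fun i => mul_le_of_le_one_left (hp i).1 ht1) hnonneg, hzero⟩
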